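/- Let n ≥ ℓ ≥ 2 and k ≥ 0 be integers with n ≥ max{6ℓ², 30kℓ}, and let G be an n-vertex K_{ℓ+1}-free graph with at least ex(n, K_{ℓ+1}) − k edges. Then there exists a set U of vertices of G with |U| ≥ n − (12ℓ²/n)·(k + ℓ/8) such that the induced subgraph G[U] satisfies δ(G[U]) > ((3ℓ−4)/(3ℓ−1))·|U|. -/

import Mathlib

/-- The Turán number `ex(n, K_{ℓ+1})`: the maximum number of edges of an
`n`-vertex `K_{ℓ+1}`-free simple graph. -/
noncomputable def turanNumber (n ℓ : ℕ) : ℕ :=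
  sSup {m : ℕ | ∃ G : SimpleGraph (Fin n), G.CliqueFree (ℓ + 1) ∧ G.edgeSet.ncard = m}

namespace SimpleGraph

theorem four_mul_sq_le_card_edgeFinset_turanGraph (n r : ℕ) :
    4 * r * n ^ 2 ≤ 8 * (r + 1) * (turanGraph n (r + 1)).edgeFinset.card + (r + 1) ^ 2 := by
  induction n using Nat.strong_induction_on with
  | _ n ih =>
    rcases lt_or_ge n (r + 1) with h | h
    · have hT : (turanGraph n (r + 1)).edgeFinset.card = n.choose 2 := by
        have hTop : turanGraph n (r + 1) = ⊤ := turanGraph_eq_top.2 (Or.inr h.le)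
        have hcard := card_edgeFinset_top_eq_card_choose_two (V := Fin n)
        rw [Fintype.card_fin] at hcard
        rw [← hcard]
        congr!
      have hc : (n.choose 2 : ℝ) = n * (n - 1) / 2 := Nat.cast_choose_two ℝ n
      rw [hT]
      have : (4 * r * n ^ 2 : ℝ) ≤ 8 * (r + 1) * (n.choose 2 : ℝ) + (r + 1) ^ 2 := by
        rw [hc]
        nlinarith [sq_nonneg (2 * (n : ℝ) - (r + 1))]
      exact_mod_cast this
    · obtain ⟨m, rfl⟩ := Nat.exists_eq_add_of_le' h
      have hm := ih m (by lia)
      have hc : (((r + 1).choose 2 : ℕ) : ℝ) = ((r + 1 : ℕ) : ℝ) * (((r + 1 : ℕ) : ℝ) - 1) / 2 :=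
        Nat.cast_choose_two ℝ (r + 1)
      rw [card_edgeFinset_turanGraph_add, Nat.add_sub_cancel]
      rify at hm ⊢
      rw [hc]
      push_cast
      nlinarith

variable {V : Type*} (G : SimpleGraph V) [DecidableRel G.Adj]

/-- The sum of the degrees of the subgraph induced on `U`. -/
def degreeSumOn (U : Finset V) : ℕ :=
  ∑ v ∈ U, (U.filter (fun u => G.Adj v u)).card

theorem degreeSumOn_univ [Fintype V] :
    G.degreeSumOn Finset.univ = 2 * G.edgeFinset.card := by
  rw [← sum_degrees_eq_twice_card_edges, degreeSumOn]
  refine Finset.sum_congr rfl fun v _ => ?_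
  rw [← card_neighborFinset_eq_degree, neighborFinset_eq_filter]

theorem degreeSumOn_eq_erase [DecidableEq V] {U : Finset V} {v : V} (hv : v ∈ U) :
    G.degreeSumOn U =
      G.degreeSumOn (U.erase v) + 2 * (U.filter (fun u => G.Adj v u)).card := by
  obtain ⟨W, hW, rfl⟩ : ∃ W, v ∉ W ∧ U = insert v W :=
    ⟨U.erase v, Finset.notMem_erase v U, (Finset.insert_erase hv).symm⟩
  simp only [degreeSumOn, Finset.card_filter, Finset.erase_insert hW, Finset.sum_insert hW,
    Finset.sum_add_distrib, G.irrefl, if_false, zero_add]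
  simp only [G.adj_comm _ v]
  ring

theorem degreeSumOn_eq_induce (U : Finset V) :
    G.degreeSumOn U = 2 * (G.induce (U : Set V)).edgeFinset.card := by
  rw [← degreeSumOn_univ, degreeSumOn, degreeSumOn]
  simp only [Finset.card_filter, comap_adj, Function.Embedding.subtype_apply]
  rw [← Finset.sum_coe_sort U]
  refine Finset.sum_congr rfl fun v _ => ?_
  exact (Finset.sum_coe_sort U fun u => if G.Adj v u then 1 else 0).symm

variable {G}

theorem CliqueFree.degreeSumOn_le {r : ℕ} (h : G.CliqueFree (r + 2)) (U : Finset V) :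
    (r + 1) * G.degreeSumOn U ≤ r * U.card ^ 2 := by
  obtain ⟨H, hdec, hH⟩ := exists_isTuranMaximal (V := (U : Set V)) (Nat.succ_pos r)
  have hfree : (G.induce (U : Set V)).CliqueFree (r + 1 + 1) :=
    h.comap (Embedding.induce (U : Set V)).isContained
  have hT : (turanGraph (Fintype.card (U : Set V)) (r + 1)).edgeFinset.card
      = H.edgeFinset.card :=
    (Iso.card_edgeFinset_eq hH.nonempty_iso_turanGraph.some).symm
  have hle := hH.2 hfree
  have hcard : Fintype.card (U : Set V) = U.card := Fintype.card_coe U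
  have hmul := mul_card_edgeFinset_turanGraph_le (n := U.card) (r := r + 1)
  rw [hcard] at hT
  rw [hT, Nat.add_sub_cancel] at hmul
  rw [degreeSumOn_eq_induce]
  nlinarith

variable (G)

/-- Deleting vertices of small degree one at a time terminates in a vertex set on which all degrees
are large, and the degree sum decreases in a controlled way. -/
theorem exists_subset_large_degree [DecidableEq V] (c : ℝ) (S : Finset V) :
    ∃ U ⊆ S,
      (G.degreeSumOn S : ℝ) - c * (S.card * (S.card + 1))
        ≤ G.degreeSumOn U - c * (U.card * (U.card + 1)) ∧
      ∀ v ∈ U, c * U.card < ((U.filter (fun u => G.Adj v u)).card : ℝ) := by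
  induction S using Finset.strongInduction with
  | H S ih =>
    by_cases hS : ∀ v ∈ S, c * S.card < ((S.filter (fun u => G.Adj v u)).card : ℝ)
    · exact ⟨S, subset_rfl, le_rfl, hS⟩
    · push Not at hS
      obtain ⟨v, hv, hdeg⟩ := hS
      obtain ⟨U, hU, hsum, hlarge⟩ := ih (S.erase v) (Finset.erase_ssubset hv)
      refine ⟨U, hU.trans (Finset.erase_subset v S), le_trans ?_ hsum, hlarge⟩
      have hcard : (S.card : ℝ) = (S.erase v).card + 1 := by
        exact_mod_cast (Finset.card_erase_add_one hv).symm
      rw [G.degreeSumOn_eq_erase hv]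
      push_cast
      rw [hcard] at hdeg ⊢
      nlinarith

end SimpleGraph

theorem card_edgeFinset_turanGraph_le_turanNumber (n : ℕ) {ℓ : ℕ} (hℓ : 0 < ℓ) :
    (SimpleGraph.turanGraph n ℓ).edgeFinset.card ≤ turanNumber n ℓ := by
  refine le_csSup ⟨Nat.card (Sym2 (Fin n)), ?_⟩
    ⟨SimpleGraph.turanGraph n ℓ, SimpleGraph.turanGraph_cliqueFree hℓ, ?_⟩
  · rintro _ ⟨H, -, rfl⟩
    exact Set.ncard_le_card _
  · rw [← SimpleGraph.coe_edgeFinset, Set.ncard_coe_finset]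

/-- Let `n ≥ ℓ ≥ 2` and `k ≥ 0` with `n ≥ max {6ℓ², 30kℓ}`, and let `G` be an
`n`-vertex `K_{ℓ+1}`-free graph with at least `ex(n,K_{ℓ+1}) - k` edges. Then
there is a vertex set `U` with `|U| ≥ n - (12ℓ²/n)(k + ℓ/8)` such that the
induced subgraph `G[U]` has minimum degree greater than `((3ℓ-4)/(3ℓ-1))|U|`
(i.e. every `v ∈ U` has more than `((3ℓ-4)/(3ℓ-1))|U|` neighbors inside `U`). -/
theorem nearTuran_large_min_degree_subgraph {V : Type*} [Fintype V]
    [DecidableEq V] (n ℓ k : ℕ)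
    (hℓ : 2 ≤ ℓ) (hn : ℓ ≤ n) (h1 : 6 * ℓ ^ 2 ≤ n) (h2 : 30 * k * ℓ ≤ n)
    (G : SimpleGraph V) [DecidableRel G.Adj] (hcard : Fintype.card V = n)
    (hfree : G.CliqueFree (ℓ + 1))
    (hedges : turanNumber n ℓ ≤ G.edgeFinset.card + k) :
    ∃ U : Finset V,
      (n : ℝ) - 12 * (ℓ : ℝ) ^ 2 / (n : ℝ) * ((k : ℝ) + (ℓ : ℝ) / 8) ≤ (U.card : ℝ) ∧
      ∀ v ∈ U,
        (3 * (ℓ : ℝ) - 4) / (3 * (ℓ : ℝ) - 1) * (U.card : ℝ)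
          < ((U.filter (fun u => G.Adj v u)).card : ℝ) := by
  obtain ⟨r, rfl⟩ : ∃ r, ℓ = r + 1 := ⟨ℓ - 1, by lia⟩
  obtain ⟨U, -, hsum, hlarge⟩ := G.exists_subset_large_degree
    ((3 * ((r + 1 : ℕ) : ℝ) - 4) / (3 * ((r + 1 : ℕ) : ℝ) - 1)) Finset.univ
  refine ⟨U, ?_, hlarge⟩
  have hturan := SimpleGraph.four_mul_sq_le_card_edgeFinset_turanGraph n r
  have hT := card_edgeFinset_turanGraph_le_turanNumber n r.succ_pos
  have hU := hfree.degreeSumOn_le U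
  have hUn : U.card ≤ n := hcard ▸ Finset.card_le_univ U
  rw [G.degreeSumOn_univ, Finset.card_univ, hcard] at hsum
  have hlower : 4 * r * n ^ 2 ≤ 8 * (r + 1) * (G.edgeFinset.card + k) + (r + 1) ^ 2 :=
    hturan.trans (by gcongr; exact hT.trans hedges)
  have hr : (1 : ℝ) ≤ r := by exact_mod_cast (by lia : 1 ≤ r)
  have hn0 : (0 : ℝ) < n := by exact_mod_cast (by lia : 0 < n)
  have hm0 : (0 : ℝ) ≤ U.card := Nat.cast_nonneg _
  have hy0 : (0 : ℝ) ≤ k := Nat.cast_nonneg _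
  rify at hU hUn hlower h1
  push_cast at hsum ⊢
  generalize (U.card : ℝ) = m at *
  generalize (G.edgeFinset.card : ℝ) = e at *
  generalize (G.degreeSumOn U : ℝ) = d at *
  generalize (n : ℝ) = N at *
  generalize (r : ℝ) = x at *
  generalize (k : ℝ) = y at *
  have hpos : 0 < 3 * (x + 1) - 1 := by linarith
  have hscaled : (3 * x + 2) * (2 * e - d) ≤ (3 * x - 1) * (N * (N + 1) - m * (m + 1)) := by
    have hmul := mul_le_mul_of_nonneg_left hsum hpos.le
    field_simp at hmul
    linarith
  have hpoly : (N - m) * (N + m - (x + 1) * (3 * x - 1))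
      ≤ (x + 1) * (3 * x + 2) * (2 * y + (x + 1) / 4) := by
    have h3 : 0 ≤ 3 * x + 2 := by linarith
    have hx1 : 0 ≤ x + 1 := by linarith
    linear_combination (x + 1) * hscaled + (3 * x + 2) * hU + (3 * x + 2) / 4 * hlower
  have hleft : (N - m) * (N / 2) ≤ (N - m) * (N + m - (x + 1) * (3 * x - 1)) := by
    refine mul_le_mul_of_nonneg_left ?_ (by linarith)
    nlinarith
  have hright : (x + 1) * (3 * x + 2) * (2 * y + (x + 1) / 4)
      ≤ (x + 1) * (3 * x + 3) * (2 * y + (x + 1) / 4) := by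
    gcongr
    norm_num
  rw [sub_le_comm, div_mul_eq_mul_div, le_div_iff₀ hn0]
  linarith
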